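/- Let λ ⊆ θ be partitions and let T be a filling of the skew shape θ/λ with positive integers such that the entries are weakly increasing along each row from left to right, and in every nonempty column of θ/λ the entries from top to bottom are exactly 1, 2, …, h, where h is the number of boxes of θ/λ in that column. Then the reading word of T (entries read right to left along each row, rows taken top to bottom) is a Yamanouchi word: in every prefix of the word, for each i ≥ 1 the number of occurrences of i is at least the number of occurrences of i+1. -/

import Mathlib

/-- The conjugate (transpose) of a partition, 0-indexed:
`conj p j = #{i | p i > j}`, i.e. `conj p (j-1) = p'_j` in 1-indexed notation.
For a skew shape `θ/λ` (with `λ ⊆ θ` partitions), the boxes in column `j`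
(0-indexed) occupy exactly the rows `conj λ j ≤ i < conj θ j`. -/
noncomputable def conj (p : ℕ → ℕ) (j : ℕ) : ℕ := Set.ncard {i : ℕ | j < p i}

/-- `p` is a partition: a weakly decreasing sequence of nonnegative integers
with finitely many nonzero terms (0-indexed parts). -/
def IsPartition (p : ℕ → ℕ) : Prop :=
  (∀ i, p (i + 1) ≤ p i) ∧ ∃ N, ∀ i, N ≤ i → p i = 0

/-- The box in row `i`, column `j` (both 0-indexed) lies in the skew shape `θ/λ`. -/
def InSkew (lam theta : ℕ → ℕ) (i j : ℕ) : Prop := lam i ≤ j ∧ j < theta i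

theorem lam_le_of_conj_le (p : ℕ → ℕ) (hp : IsPartition p) (j k : ℕ)
    (h : conj p j ≤ k) : p k ≤ j := by
  by_contra hlt
  push Not at hlt
  have hanti : Antitone p := antitone_nat_of_succ_le hp.1
  obtain ⟨N, hN⟩ := hp.2
  have hfin : Set.Finite {i : ℕ | j < p i} := by
    refine (Set.finite_Iio N).subset ?_
    intro i hi
    by_contra hc
    simp only [Set.mem_Iio, not_lt] at hc
    have := hN i hc
    simp only [Set.mem_ofPred_eq] at hi
    omega
  have hsub : (↑(Finset.range (k + 1)) : Set ℕ) ⊆ {i : ℕ | j < p i} := by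
    intro i hi
    simp only [Finset.coe_range, Set.mem_Iio] at hi
    exact lt_of_lt_of_le hlt (hanti (by omega))
  have hc := Set.ncard_le_ncard hsub hfin
  rw [Set.ncard_coe_finset, Finset.card_range] at hc
  unfold conj at h
  omega

/-- Let `λ ⊆ θ` be partitions and `T` a filling of `θ/λ` whose rows
weakly increase left to right, and such that each nonempty column of `θ/λ` is filled,
from top to bottom, with exactly `1, 2, …, h` (`h` the number of boxes of the column);
since the boxes of `θ/λ` in column `j` are the rows `conj λ j ≤ i < conj θ j`, this
says `T i j = i - conj λ j + 1` on the shape.  Then the reading word of `T` (entries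
read right to left along rows, rows top to bottom) is Yamanouchi: every prefix
(the boxes `(i,j)` of the shape with `i < m`, or `i = m` and `j ≥ c`) contains,
for each `e ≥ 1`, at least as many occurrences of `e` as of `e + 1`. -/
theorem yamanouchi_of_column_filling (lam theta : ℕ → ℕ)
    (hlam : IsPartition lam) (htheta : IsPartition theta)
    (hsub : ∀ i, lam i ≤ theta i) (T : ℕ → ℕ → ℕ)
    (hrow : ∀ i j1 j2, InSkew lam theta i j1 → InSkew lam theta i j2 →
      j1 ≤ j2 → T i j1 ≤ T i j2)
    (hcol : ∀ i j, InSkew lam theta i j → T i j = i - conj lam j + 1) :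
    ∀ m c e, 1 ≤ e →
      Set.ncard {p : ℕ × ℕ | InSkew lam theta p.1 p.2 ∧
          (p.1 < m ∨ (p.1 = m ∧ c ≤ p.2)) ∧ T p.1 p.2 = e + 1} ≤
        Set.ncard {p : ℕ × ℕ | InSkew lam theta p.1 p.2 ∧
          (p.1 < m ∨ (p.1 = m ∧ c ≤ p.2)) ∧ T p.1 p.2 = e} := by
  intro m c e he
  have hanti : Antitone theta := antitone_nat_of_succ_le htheta.1
  have key : ∀ i j, InSkew lam theta i j → T i j = e + 1 → conj lam j + 1 ≤ i := by
    intro i j hs hT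
    have := hcol i j hs
    omega
  refine Set.ncard_le_ncard_of_injOn (fun p : ℕ × ℕ => (p.1 - 1, p.2)) ?_ ?_ ?_
  · rintro ⟨i, j⟩ ⟨hs, hm, hT⟩
    simp only at hs hm hT
    have hk := key i j hs hT
    have h1 := hcol i j hs
    have hs' : InSkew lam theta (i - 1) j :=
      ⟨lam_le_of_conj_le lam hlam j (i - 1) (by omega),
        lt_of_lt_of_le hs.2 (hanti (by omega))⟩
    refine ⟨hs', ?_, ?_⟩
    · left
      show i - 1 < m
      omega
    · show T (i - 1) j = e
      rw [hcol _ _ hs']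
      omega
  · rintro ⟨i, j⟩ ⟨hs, hm, hT⟩ ⟨i', j'⟩ ⟨hs', hm', hT'⟩ heq
    have hk := key i j hs hT
    have hk' := key i' j' hs' hT'
    simp only [Prod.mk.injEq] at heq ⊢
    omega
  · refine ((Set.finite_Iic m).prod (Set.finite_Iio (theta 0))).subset ?_
    rintro ⟨i, j⟩ ⟨hs, hm, hT⟩
    simp only at hs hm
    refine ⟨?_, ?_⟩
    · show i ≤ m
      omega
    · exact lt_of_lt_of_le hs.2 (hanti (Nat.zero_le i))
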